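/- Let I ⊂ ℝ be a finite interval, ε > 0 and L ∈ ℤ_{≥0}. There is a constant C depending only on I, ε and L such that for all s = σ + it with σ ∈ I and t ≥ ε, |Γ(s)·(√(2π))^{−1}·exp(−πis/2 + it + πi/4)·t^{1/2−s} − Σ_{m=0}^{L−1} γ_m(σ)/t^m| ≤ C/t^L, i.e. Γ(s) = √(2π)·exp(πis/2 − it − πi/4)·t^{s−1/2}·(Σ_{m=0}^{L−1} γ_m(σ)/t^m + O(1/t^L)), where t^{s−1/2} denotes exp((s − 1/2)·log t) with the real logarithm of t > 0. -/

import Mathlib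

open Complex Real MeasureTheory

noncomputable section

def chi (s : ℂ) : ℂ := (π : ℂ) ^ (s - 1/2) * Complex.Gamma ((1 - s)/2) / Complex.Gamma (s/2)

def RSOmega : Set ℂ := {s : ℂ | s.im ≠ 0 ∨ (0 < s.re ∧ s.re < 1)}

def IsRSTheta (ϑ : ℂ → ℂ) : Prop :=
  DifferentiableOn ℂ ϑ RSOmega ∧ (∀ s ∈ RSOmega, Complex.exp (-2 * I * ϑ s) = chi s) ∧
    ϑ (1/2) = 0

def zetaSum (x : ℝ) (s : ℂ) : ℂ := ∑ n ∈ Finset.Icc 1 ⌊x⌋₊, (n : ℂ) ^ (-s)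

def Upsilon (u τ : ℂ) : ℂ :=
  ∫ v : ℝ, Complex.exp (3 * (π:ℂ) * I / 4) *
    (Complex.exp (-(π:ℂ) * I * τ * (1/2 + Complex.exp (3 * (π:ℂ) * I / 4) * v) ^ 2
        + 2 * (π:ℂ) * I * u * (1/2 + Complex.exp (3 * (π:ℂ) * I / 4) * v)) /
      (Complex.exp (2 * (π:ℂ) * I * (1/2 + Complex.exp (3 * (π:ℂ) * I / 4) * v)) - 1))

def G (u τ : ℂ) : ℂ :=
  τ ^ ((1:ℂ)/4) * Complex.exp (-(π:ℂ) * I * u ^ 2 / 2 + (π:ℂ) * I / 8) *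
    Upsilon (τ ^ ((1:ℂ)/2) * u) τ

def Gderiv (k : ℕ) (u τ : ℂ) : ℂ := iteratedDeriv k (fun w => G w τ) u

def hermiteH (n : ℕ) (x : ℂ) : ℂ :=
  (Nat.factorial n : ℂ) * ∑ j ∈ Finset.range (n / 2 + 1),
    (-1:ℂ) ^ j / ((Nat.factorial j : ℂ) * (Nat.factorial (n - 2*j) : ℂ)) * (2 * x) ^ (n - 2*j)

def obell (p : ℕ → ℂ) (i j : ℕ) : ℂ :=
  ∑ f ∈ (Finset.Nat.antidiagonalTuple j i).filter (fun f => ∀ l, 1 ≤ f l), ∏ l, p (f l)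

def bernoulliPoly (n : ℕ) (x : ℂ) : ℂ := Polynomial.aeval x (Polynomial.bernoulli n)

def fseq (σ : ℝ) (n : ℕ) : ℂ :=
  (bernoulliPoly (n+1) ((σ:ℂ)/2) + (-1:ℂ)^(n+1) * bernoulliPoly (n+1) ((1-(σ:ℂ))/2)) /
    (2*(n:ℂ)*((n:ℂ)+1))

def um (m : ℕ) (σ : ℝ) : ℂ :=
  (-2:ℂ)^m * ∑ k ∈ Finset.range (m+1), obell (fseq σ) m k / (Nat.factorial k : ℂ)

def seqA (j : ℕ) : ℂ := (-1:ℂ)^(j+1) / ((j:ℂ) + 2)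

def seqB (j : ℕ) : ℂ := (-1:ℂ)^(j+1) / (j:ℂ)

def dd (m r : ℕ) (σ : ℝ) : ℂ :=
  ∑ n ∈ Finset.Icc r m, (obell seqA n r / (Nat.factorial r : ℂ)) *
    ∑ k ∈ Finset.range (m - n + 1),
      (obell seqB (m - n) k / (Nat.factorial k : ℂ)) * ((σ:ℂ) - 1)^k

def qq (n ℓ : ℕ) (σ : ℝ) : ℂ :=
  ∑ m ∈ Finset.Icc (ℓ - n) (ℓ / 3), um m σ * dd (n - 2*m) (n + m - ℓ) σ

def PP (n k : ℕ) (x : ℂ) (σ : ℝ) : ℂ :=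
  Complex.exp (3 * (π:ℂ) * I * (k:ℂ) / 4) * ∑ ℓ ∈ Finset.range (k/2 + 1),
    (Nat.choose (3*n - 2*ℓ) (3*n - k) : ℂ) * (-1:ℂ)^(n + ℓ) * 2^(2*ℓ) / 2^k *
      qq n ℓ σ * hermiteH (k - 2*ℓ) (Complex.exp (-(π:ℂ) * I / 4) * x)

def IsAk (s : ℂ) (a : ℕ → ℂ) : Prop :=
  a 0 = 1 ∧ ∀ k : ℕ, ((k:ℂ) + 1) * (Real.sqrt s.im : ℂ) * a (k+1) =
    -((k:ℂ) + 1 - (s.re:ℂ)) * a k + I * (if 2 ≤ k then a (k-2) else 0)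

def IsPsi (Ψ : ℂ → ℂ) : Prop :=
  Differentiable ℂ Ψ ∧ ∀ u : ℂ, Complex.cos ((π:ℂ)*u) ≠ 0 →
    Ψ u = Complex.cos ((π:ℂ)*(u^2/2 - u - 1/8)) / Complex.cos ((π:ℂ)*u)

def wfun (s z : ℂ) : ℂ :=
  Complex.exp ((s - 1) * Complex.log (1 + z / (Real.sqrt s.im : ℂ))
    - I * (Real.sqrt s.im : ℂ) * z + I * z^2 / 2)

def rn (n : ℕ) (s z : ℂ) : ℂ :=
  wfun s z - ∑ k ∈ Finset.range n, (iteratedDeriv k (wfun s) 0 / (Nat.factorial k : ℂ)) * z^k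

def GammaOmega : Set ℂ := {s : ℂ | s.im ≠ 0 ∨ 0 < s.re}

def IsLogGamma (L : ℂ → ℂ) : Prop :=
  DifferentiableOn ℂ L GammaOmega ∧ (∀ s ∈ GammaOmega, Complex.exp (L s) = Complex.Gamma s) ∧
    L 1 = 0

def gseq (σ : ℝ) (n : ℕ) : ℂ := -(bernoulliPoly (n+1) (σ:ℂ)) / ((n:ℂ)*((n:ℂ)+1))

def gammam (m : ℕ) (σ : ℝ) : ℂ :=
  I^m * ∑ k ∈ Finset.range (m+1), obell (gseq σ) m k / (Nat.factorial k : ℂ)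

lemma bern_add_one (n : ℕ) (x : ℂ) :
    bernoulliPoly n (x + 1) = bernoulliPoly n x + n * x ^ (n - 1) := by
  have h := congrArg (Polynomial.aeval x) (Polynomial.bernoulli_comp_one_add_X n)
  rw [Polynomial.aeval_comp] at h
  simp only [map_add, map_one, Polynomial.aeval_X, map_nsmul, map_pow] at h
  unfold bernoulliPoly
  rw [add_comm x 1, h, nsmul_eq_mul]

lemma bern_deriv (n : ℕ) (x : ℂ) :
    HasDerivAt (bernoulliPoly (n + 1)) (((n : ℂ) + 1) * bernoulliPoly n x) x := by
  have h := (Polynomial.bernoulli (n + 1)).hasDerivAt_aeval x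
  rw [Polynomial.derivative_bernoulli_add_one] at h
  have e : (Polynomial.aeval x) (((n : Polynomial ℚ) + 1) * Polynomial.bernoulli n) =
      ((n : ℂ) + 1) * bernoulliPoly n x := by
    simp [bernoulliPoly]
  rw [e] at h
  exact h

lemma bern_cont (n : ℕ) : Continuous (bernoulliPoly n) :=
  (Polynomial.bernoulli n).continuous_aeval

def DD (N : ℕ) (z a : ℂ) : ℂ :=
  (z + a - 1 / 2) * Complex.log z - z + ∑ n ∈ Finset.range N,
    (-1 : ℂ) ^ n * bernoulliPoly (n + 2) a / (((n : ℂ) + 1) * ((n : ℂ) + 2)) * (z ^ (n + 1))⁻¹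

lemma DD_shift (N : ℕ) (z a : ℂ) (hz : z ≠ 0) :
    DD N z (a + 1) - DD N z a = Complex.log z + Complex.logTaylor (N + 1) (a / z) := by
  have h1 : Complex.logTaylor (N + 1) (a / z) =
      ∑ n ∈ Finset.range N, (-1 : ℂ) ^ n * (a / z) ^ (n + 1) / ((n : ℂ) + 1) := by
    unfold Complex.logTaylor
    rw [Finset.sum_range_succ']
    simp [pow_succ]
  have h2 : ∀ n : ℕ, (-1 : ℂ) ^ n * bernoulliPoly (n + 2) (a + 1) /
      (((n : ℂ) + 1) * ((n : ℂ) + 2)) * (z ^ (n + 1))⁻¹ =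
      (-1 : ℂ) ^ n * bernoulliPoly (n + 2) a / (((n : ℂ) + 1) * ((n : ℂ) + 2)) * (z ^ (n + 1))⁻¹
      + (-1 : ℂ) ^ n * (a / z) ^ (n + 1) / ((n : ℂ) + 1) := by
    intro n
    have e1 : (n : ℂ) + 1 ≠ 0 := by exact_mod_cast (Nat.succ_ne_zero n)
    have e2 : (n : ℂ) + 2 ≠ 0 := by exact_mod_cast (Nat.succ_ne_zero (n + 1))
    rw [bern_add_one, div_pow]
    have : n + 2 - 1 = n + 1 := rfl
    rw [this]
    push_cast
    field_simp
  unfold DD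
  simp_rw [h2]
  rw [Finset.sum_add_distrib, h1]
  ring

lemma DD_deriv (N : ℕ) (z a h : ℂ) (hz : z + h ∈ Complex.slitPlane) :
    HasDerivAt (fun h => DD N (z + h) (a - h))
      ((-1 : ℂ) ^ N * bernoulliPoly (N + 1) (a - h) / ((N : ℂ) + 1) * ((z + h) ^ (N + 1))⁻¹) h := by
  have hne : z + h ≠ 0 := Complex.slitPlane_ne_zero hz
  have hzh : HasDerivAt (fun h : ℂ => z + h) 1 h := (hasDerivAt_id h).const_add z
  have hah : HasDerivAt (fun h : ℂ => a - h) (-1) h := (hasDerivAt_id h).const_sub a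
  induction N with
  | zero =>
    have h1 : HasDerivAt (fun h => (z + a - 1 / 2) * Complex.log (z + h) - (z + h))
        ((z + a - 1 / 2) * (1 / (z + h)) - 1) h :=
      ((hzh.clog hz).const_mul _).sub hzh
    convert h1 using 1
    · funext h
      simp [DD]
    · simp [bernoulliPoly]
      field_simp
      ring
  | succ N ih =>
    have e1 : (N : ℂ) + 1 ≠ 0 := by exact_mod_cast (Nat.succ_ne_zero N)
    have e2 : (N : ℂ) + 2 ≠ 0 := by exact_mod_cast (Nat.succ_ne_zero (N + 1))
    have e3 : (N : ℂ) + 1 + 1 ≠ 0 := by rw [add_assoc]; norm_num [e2]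
    have hb : HasDerivAt (fun h => bernoulliPoly (N + 2) (a - h))
        ((((N + 1 : ℕ) : ℂ) + 1) * bernoulliPoly (N + 1) (a - h) * (-1)) h :=
      (bern_deriv (N + 1) (a - h)).comp h hah
    have hp := (hzh.pow (N + 1)).inv (pow_ne_zero _ hne)
    have h2 := ih.add (((hb.const_mul ((-1 : ℂ) ^ N)).div_const
      (((N : ℂ) + 1) * ((N : ℂ) + 2))).mul hp)
    have ef : (fun h => DD (N + 1) (z + h) (a - h)) = ((fun h => DD N (z + h) (a - h)) +
      (fun x => (-1) ^ N * bernoulliPoly (N + 2) (a - x) / ((↑N + 1) * (↑N + 2))) *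
        ((fun h => z + h) ^ (N + 1))⁻¹) := by
      funext h
      simp [DD, Finset.sum_range_succ]
      ring
    rw [ef]
    refine h2.congr_deriv ?_
    · push_cast
      simp only [Pi.pow_apply, Pi.inv_apply, Nat.add_sub_cancel, mul_one]
      field_simp
      ring

lemma eta_bound (A B : ℝ) (N : ℕ) : ∃ K : ℝ, 0 ≤ K ∧ ∀ a ∈ Set.Icc A B, ∀ z : ℂ, 0 ≤ z.re →
    0 < z.im → 2 * (|A| + |B| + 1) ≤ ‖z‖ →
    ‖DD N (z + 1) a - DD N z a - Complex.log z - Complex.log (1 + a / z)‖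
      ≤ K / ‖z‖ ^ (N + 1) := by
  obtain ⟨M, hM⟩ := (isCompact_Icc (a := A) (b := B + 1)).exists_bound_of_continuousOn
    (f := fun x : ℝ => bernoulliPoly (N + 1) (x : ℂ))
    ((bern_cont (N + 1)).comp Complex.continuous_ofReal).continuousOn
  set R := |A| + |B| + 1 with hR
  have hR1 : 1 ≤ R := by have := abs_nonneg A; have := abs_nonneg B; linarith
  refine ⟨|M| + 2 * R ^ (N + 1), by positivity, ?_⟩
  intro a ha z hz0 hzi hzn
  have hzpos : 0 < ‖z‖ := by linarith
  have hzne : z ≠ 0 := norm_pos_iff.mp hzpos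
  have haR : |a| ≤ R := by
    rw [abs_le]
    have := abs_nonneg A; have := abs_nonneg B
    have := neg_abs_le A; have := le_abs_self B
    constructor <;> linarith [ha.1, ha.2]
  have hNpos : (0 : ℝ) < (N : ℝ) + 1 := by positivity
  have hN1 : (1 : ℝ) ≤ (N : ℝ) + 1 := by
    have : (0 : ℝ) ≤ N := Nat.cast_nonneg N
    linarith
  -- first part
  have hA : ‖DD N (z + 1) a - DD N z (a + 1)‖ ≤ |M| / ‖z‖ ^ (N + 1) := by
    have key := norm_image_sub_le_of_norm_deriv_le_segment_01'
      (f := fun h : ℝ => DD N (z + h) ((a + 1 : ℂ) - h))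
      (f' := fun h : ℝ => (-1 : ℂ) ^ N * bernoulliPoly (N + 1) ((a + 1 : ℂ) - h) / ((N : ℂ) + 1)
        * ((z + h) ^ (N + 1))⁻¹) (C := |M| / ‖z‖ ^ (N + 1)) ?_ ?_
    · simpa using key
    · intro h hh
      have : z + (h : ℂ) ∈ Complex.slitPlane := by
        right
        simp [hzi.ne']
      exact (DD_deriv N z (a + 1) h this).comp_ofReal.hasDerivWithinAt
    · intro h hh
      have hle : ‖z‖ ≤ ‖z + h‖ := by
        rw [Complex.norm_def, Complex.norm_def]
        apply Real.sqrt_le_sqrt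
        simp [Complex.normSq_apply]
        nlinarith [hh.1]
      have hb := hM (a + 1 - h) ⟨by linarith [ha.1, hh.2], by linarith [ha.2, hh.1]⟩
      push_cast at hb
      have hnn : ‖((N : ℂ) + 1)‖ = (N : ℝ) + 1 := by
        have : ((N : ℂ) + 1) = ((N + 1 : ℕ) : ℂ) := by push_cast; rfl
        rw [this, Complex.norm_natCast]; push_cast; rfl
      rw [norm_mul, norm_div, norm_mul, norm_pow, norm_neg, norm_one, one_pow, one_mul, norm_inv,
        norm_pow, hnn, ← div_eq_mul_inv]
      have : ‖bernoulliPoly (N + 1) ((a + 1 : ℂ) - h)‖ / ((N : ℝ) + 1) ≤ |M| :=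
        (div_le_self (norm_nonneg _) hN1).trans (hb.trans (le_abs_self M))
      gcongr
  have hw : ‖(a : ℂ) / z‖ ≤ R / ‖z‖ := by
    rw [norm_div, Complex.norm_real, Real.norm_eq_abs]
    gcongr
  have hw2 : ‖(a : ℂ) / z‖ ≤ 1 / 2 := by
    refine hw.trans ?_
    rw [div_le_div_iff₀ hzpos (by norm_num)]
    linarith
  have hB : ‖Complex.log (1 + a / z) - Complex.logTaylor (N + 1) (a / z)‖
      ≤ 2 * R ^ (N + 1) / ‖z‖ ^ (N + 1) := by
    refine (Complex.norm_log_sub_logTaylor_le N (by linarith)).trans ?_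
    have h1 : (1 - ‖(a : ℂ) / z‖)⁻¹ ≤ 2 := by
      rw [inv_le_comm₀ (by linarith) (by norm_num)]
      linarith
    have h0 : 0 ≤ (1 - ‖(a : ℂ) / z‖)⁻¹ := inv_nonneg.mpr (by linarith)
    calc _ ≤ ‖(a : ℂ) / z‖ ^ (N + 1) * (1 - ‖(a : ℂ) / z‖)⁻¹ := div_le_self (by positivity) hN1
      _ ≤ (R / ‖z‖) ^ (N + 1) * 2 := by gcongr
      _ = _ := by rw [div_pow]; ring
  have hsh := DD_shift N z a hzne
  have : DD N (z + 1) a - DD N z a - Complex.log z - Complex.log (1 + a / z) =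
      (DD N (z + 1) a - DD N z (a + 1)) -
        (Complex.log (1 + a / z) - Complex.logTaylor (N + 1) (a / z)) := by
    linear_combination hsh
  rw [this, add_div]
  exact (norm_sub_le _ _).trans (add_le_add hA hB)

def etaF (N : ℕ) (z a : ℂ) : ℂ :=
  DD N (z + 1) a - DD N z a - Complex.log z - Complex.log (1 + a / z)

lemma exp_step (N : ℕ) (z a : ℂ) (hz : z ≠ 0) (hza : z + a ≠ 0) :
    Complex.exp (DD N (z + 1) a) =
      Complex.exp (DD N z a) * (z + a) * Complex.exp (etaF N z a) := by
  have h1 : (1 + a / z) ≠ 0 := by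
    intro h
    apply hza
    have h2 : z + a = z * (1 + a / z) := by field_simp
    rw [h2, h, mul_zero]
  have : DD N (z + 1) a = DD N z a + Complex.log z + Complex.log (1 + a / z) + etaF N z a := by
    unfold etaF; ring
  rw [this, Complex.exp_add, Complex.exp_add, Complex.exp_add, Complex.exp_log hz,
    Complex.exp_log h1]
  field_simp

lemma exp_prod (N : ℕ) (z a : ℂ) (hz : 0 < z.im) (ha : a.im = 0) (n : ℕ) :
    Complex.exp (DD N (z + n) a) =
      Complex.exp (DD N z a) * (∏ j ∈ Finset.range n, (z + a + j)) *
        Complex.exp (∑ j ∈ Finset.range n, etaF N (z + j) a) := by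
  induction n with
  | zero => simp
  | succ n ih =>
    have h1 : (z + n) ≠ 0 := by
      intro h
      have := congrArg Complex.im h
      simp at this
      linarith
    have h2 : (z + n + a) ≠ 0 := by
      intro h
      have := congrArg Complex.im h
      simp [ha] at this
      linarith
    have := exp_step N (z + n) a h1 h2
    rw [Finset.prod_range_succ, Finset.sum_range_succ, Complex.exp_add]
    push_cast
    rw [← add_assoc, this, ih]
    ring

open Filter Topology in
lemma lim_exponent (N : ℕ) (z a : ℂ) :
    Tendsto (fun n : ℕ => z + 1 - (z + a + 1 / 2 + n) * Complex.log (1 + (z + 1) / n)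
      - ∑ k ∈ Finset.range N, (-1 : ℂ) ^ k * bernoulliPoly (k + 2) a /
        (((k : ℂ) + 1) * ((k : ℂ) + 2)) * ((z + (n + 1 : ℕ)) ^ (k + 1))⁻¹) atTop (𝓝 0) := by
  have hinv : Tendsto (fun n : ℕ => (z + (n + 1 : ℕ))⁻¹) atTop (𝓝 0) := by
    rw [tendsto_zero_iff_norm_tendsto_zero]
    simp_rw [norm_inv]
    refine tendsto_inv_atTop_zero.comp ?_
    refine tendsto_atTop_mono (f := fun n : ℕ => z.re + (n + 1 : ℕ)) ?_ ?_
    · intro n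
      refine le_trans ?_ (Complex.re_le_norm _)
      simp
    · exact tendsto_atTop_add_const_left _ _
        (tendsto_natCast_atTop_atTop.comp (tendsto_add_atTop_nat 1))
  have hsum : Tendsto (fun n : ℕ => ∑ k ∈ Finset.range N, (-1 : ℂ) ^ k * bernoulliPoly (k + 2) a /
        (((k : ℂ) + 1) * ((k : ℂ) + 2)) * ((z + (n + 1 : ℕ)) ^ (k + 1))⁻¹) atTop (𝓝 0) := by
    have : (0 : ℂ) = ∑ k ∈ Finset.range N, (-1 : ℂ) ^ k * bernoulliPoly (k + 2) a /
        (((k : ℂ) + 1) * ((k : ℂ) + 2)) * 0 ^ (k + 1) := by simp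
    rw [this]
    refine tendsto_finsetSum _ fun k _ => ?_
    simp_rw [← inv_pow]
    exact (hinv.pow (k + 1)).const_mul _
  have hdiv : Tendsto (fun n : ℕ => (z + 1) / (n : ℂ)) atTop (𝓝 0) := by
    have := (tendsto_inv_atTop_nhds_zero_nat (𝕜 := ℂ)).const_mul (z + 1)
    simpa [div_eq_mul_inv] using this
  have hl0 : Tendsto (fun n : ℕ => Complex.log (1 + (z + 1) / n)) atTop (𝓝 0) := by
    have hc : ContinuousAt Complex.log 1 := continuousAt_clog (by simp)
    have h1 : Tendsto (fun n : ℕ => 1 + (z + 1) / (n : ℂ)) atTop (𝓝 1) := by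
      simpa using hdiv.const_add 1
    have := hc.tendsto.comp h1
    rw [Complex.log_one] at this
    exact this
  have hl1 : Tendsto (fun n : ℕ => (n : ℂ) * Complex.log (1 + (z + 1) / n)) atTop (𝓝 (z + 1)) := by
    refine Complex.tendsto_nat_mul_log_one_add_of_tendsto ?_
    refine tendsto_const_nhds.congr' ?_
    filter_upwards [eventually_ne_atTop 0] with n hn
    have : (n : ℂ) ≠ 0 := by exact_mod_cast hn
    field_simp
  have := ((tendsto_const_nhds (x := z + 1)).sub
    ((hl0.const_mul (z + a + 1 / 2)).add hl1)).sub hsum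
  simp only [mul_zero, zero_add, sub_self, sub_zero] at this
  refine this.congr fun n => ?_
  ring

open Filter Topology in
lemma lim_main (N : ℕ) (z a : ℂ) (hz : 0 < z.im) :
    Tendsto (fun n : ℕ => (n : ℂ) ^ (z + a) * (Nat.factorial n : ℂ) /
      Complex.exp (DD N (z + (n + 1 : ℕ)) a)) atTop (𝓝 ((Real.sqrt (2 * π) : ℝ) : ℂ)) := by
  have h1 : Tendsto (fun n : ℕ => ((Stirling.stirlingSeq n : ℝ) : ℂ) * ((Real.sqrt 2 : ℝ) : ℂ))
      atTop (𝓝 ((Real.sqrt (2 * π) : ℝ) : ℂ)) := by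
    have := (Complex.continuous_ofReal.tendsto _).comp Stirling.tendsto_stirlingSeq_sqrt_pi
    have := this.mul_const ((Real.sqrt 2 : ℝ) : ℂ)
    rw [← Complex.ofReal_mul, ← Real.sqrt_mul pi_pos.le, mul_comm π 2] at this
    exact this
  have h2 := h1.mul ((Complex.continuous_exp.tendsto _).comp (lim_exponent N z a))
  simp only [Complex.exp_zero, mul_one] at h2
  refine h2.congr' ?_
  filter_upwards [eventually_gt_atTop 0] with n hn
  have hnR : (0 : ℝ) < n := by exact_mod_cast hn
  have hnC : (n : ℂ) ≠ 0 := by exact_mod_cast hn.ne'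
  have hfac : (Nat.factorial n : ℝ) = Stirling.stirlingSeq n * (Real.sqrt 2) *
      Real.exp (Real.log n / 2 + n * Real.log n - n) := by
    have e1 : Real.exp (Real.log n / 2 + n * Real.log n - n) =
        Real.sqrt n * (n / Real.exp 1) ^ n := by
      rw [Real.exp_sub, Real.exp_add, ← Real.log_sqrt hnR.le, Real.exp_log (Real.sqrt_pos.mpr hnR),
        div_pow, ← Real.exp_nat_mul, mul_one, mul_div_assoc, mul_comm (n : ℝ) (Real.log n),
        Real.exp_mul, Real.exp_log hnR, Real.rpow_natCast]
    rw [e1, Stirling.stirlingSeq, Real.sqrt_mul (by norm_num : (0 : ℝ) ≤ 2)]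
    have := Real.sqrt_pos.mpr hnR
    have := Real.exp_pos 1
    have : (0 : ℝ) < Real.sqrt 2 := by positivity
    field_simp
  have hfacC : (Nat.factorial n : ℂ) = (Stirling.stirlingSeq n : ℝ) * ((Real.sqrt 2 : ℝ) : ℂ) *
      Complex.exp (Real.log n / 2 + n * Real.log n - n) := by
    have := congrArg (fun x : ℝ => (x : ℂ)) hfac
    push_cast at this
    push_cast
    exact this
  have hlog : Complex.log (z + (n + 1 : ℕ)) = Real.log n + Complex.log (1 + (z + 1) / n) := by
    have e : z + ((n + 1 : ℕ) : ℂ) = ((n : ℝ) : ℂ) * (1 + (z + 1) / n) := by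
      push_cast
      field_simp
      ring
    have hne : (1 + (z + 1) / (n : ℂ)) ≠ 0 := by
      intro h
      rw [h, mul_zero] at e
      have := congrArg Complex.im e
      simp at this
      linarith
    rw [e, Complex.log_ofReal_mul hnR hne]
  have hpow : (n : ℂ) ^ (z + a) = Complex.exp ((Real.log n : ℝ) * (z + a)) := by
    rw [Complex.cpow_def_of_ne_zero hnC, Complex.ofReal_log hnR.le, Complex.ofReal_natCast]
  rw [hfacC, hpow, div_eq_mul_inv (Complex.exp _ * _), ← Complex.exp_neg, DD, hlog]
  simp only [Function.comp]
  rw [show ∀ x y w q r : ℂ, Complex.exp x * (y * w * Complex.exp q) * Complex.exp r =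
    y * w * Complex.exp (x + q + r) by
      intro x y w q r; rw [Complex.exp_add, Complex.exp_add]; ring]
  congr 2
  push_cast
  ring

lemma sum_inv_bound : ∃ S : ℝ, 0 ≤ S ∧ ∀ n : ℕ,
    ∑ j ∈ Finset.range n, 1 / (1 + (j : ℝ) ^ 2) ≤ S := by
  have h1 : Summable (fun j : ℕ => 1 / (1 + (j : ℝ) ^ 2)) := by
    have h2 : Summable (fun j : ℕ => 2 * (1 / ((j + 1 : ℕ) : ℝ) ^ 2)) :=
      (((summable_nat_add_iff 1).mpr
        (Real.summable_one_div_nat_pow.mpr (by norm_num : 1 < 2)))).mul_left 2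
    refine Summable.of_nonneg_of_le (fun j => by positivity) (fun j => ?_) h2
    push_cast
    rw [mul_one_div, div_le_div_iff₀ (by positivity) (by positivity)]
    nlinarith [sq_nonneg ((j : ℝ) - 1)]
  exact ⟨_, tsum_nonneg (fun j => by positivity), fun n =>
    h1.sum_le_tsum _ (fun j _ => by positivity)⟩

open Filter Topology in
lemma gamma_main (A B : ℝ) (L : ℕ) : ∃ C T : ℝ, 1 ≤ T ∧ ∀ a ∈ Set.Icc A B, ∀ t : ℝ, T ≤ t →
    ‖Complex.Gamma (I * t + a) / (((Real.sqrt (2 * π) : ℝ) : ℂ) *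
      Complex.exp (DD (L + 1) (I * t) a)) - 1‖ ≤ C / t ^ L := by
  obtain ⟨K, hK0, hK⟩ := eta_bound A B (L + 1)
  obtain ⟨S, hS0, hS⟩ := sum_inv_bound
  refine ⟨K * S * Real.exp (K * S), 2 * (|A| + |B| + 1), ?_, ?_⟩
  · have := abs_nonneg A; have := abs_nonneg B; linarith
  intro a ha t ht
  have ht1 : 1 ≤ t := by have := abs_nonneg A; have := abs_nonneg B; linarith
  have ht0 : 0 < t := by linarith
  have hzim : 0 < (I * (t : ℂ)).im := by simpa using ht0
  have hsum : ∀ n, ‖∑ j ∈ Finset.range n, etaF (L + 1) (I * t + j) a‖ ≤ K * S / t ^ L := by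
    intro n
    have hterm : ∀ j ∈ Finset.range n, ‖etaF (L + 1) (I * t + j) a‖ ≤
        K / t ^ L * (1 / (1 + (j : ℝ) ^ 2)) := by
      intro j _
      have hsq : ‖I * (t : ℂ) + j‖ ^ 2 = t ^ 2 + (j : ℝ) ^ 2 := by
        rw [Complex.sq_norm, Complex.normSq_apply]
        simp
        ring
      have htle : t ≤ ‖I * (t : ℂ) + j‖ := by
        refine le_trans ?_ (Complex.im_le_norm _)
        simp
      have := hK a ha (I * t + j) (by simp) (by simpa using ht0) (ht.trans htle)
      refine this.trans ?_
      rw [div_mul_div_comm, mul_one]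
      have hp : t ^ L * (1 + (j : ℝ) ^ 2) ≤ ‖I * (t : ℂ) + j‖ ^ (L + 1 + 1) := by
        rw [add_assoc, pow_add, show 1 + 1 = 2 from rfl, hsq]
        have : 1 + (j : ℝ) ^ 2 ≤ t ^ 2 + (j : ℝ) ^ 2 := by nlinarith
        gcongr
      gcongr
    refine (norm_sum_le _ _).trans ((Finset.sum_le_sum hterm).trans ?_)
    rw [← Finset.mul_sum, mul_div_right_comm]
    have := hS n
    gcongr
  have hKS : K * S / t ^ L ≤ K * S := div_le_self (by positivity) (one_le_pow₀ ht1)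
  have hexp : ∀ n, ‖Complex.exp (∑ j ∈ Finset.range n, etaF (L + 1) (I * t + j) a) - 1‖ ≤
      K * S * Real.exp (K * S) / t ^ L := by
    intro n
    set w := ∑ j ∈ Finset.range n, etaF (L + 1) (I * t + j) a
    have h1 := Complex.norm_exp_sub_sum_le_norm_mul_exp w 1
    simp only [Finset.sum_range_one, pow_zero, Nat.factorial_zero, Nat.cast_one, div_one,
      pow_one] at h1
    have h2 : ‖w‖ ≤ K * S / t ^ L := hsum n
    calc _ ≤ ‖w‖ * Real.exp ‖w‖ := h1
      _ ≤ K * S / t ^ L * Real.exp (K * S) := by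
        have := h2.trans hKS
        gcongr
      _ = _ := by ring
  set z : ℂ := I * t with hz
  have hsqrt : ((Real.sqrt (2 * π) : ℝ) : ℂ) ≠ 0 := by
    have : 0 < Real.sqrt (2 * π) := Real.sqrt_pos.mpr (by positivity)
    exact_mod_cast this.ne'
  have hlim : Tendsto (fun n : ℕ => Complex.exp (∑ j ∈ Finset.range (n + 1),
      etaF (L + 1) (z + j) a)) atTop (𝓝 (Complex.Gamma (z + a) / (((Real.sqrt (2 * π) : ℝ) : ℂ) *
      Complex.exp (DD (L + 1) z a)))) := by
    have h1 := ((Complex.GammaSeq_tendsto_Gamma (z + a)).div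
      (lim_main (L + 1) z a hzim) hsqrt).div_const (Complex.exp (DD (L + 1) z a))
    rw [div_div] at h1
    refine h1.congr' ?_
    filter_upwards [eventually_gt_atTop 0] with n hn
    have hnC : (n : ℂ) ≠ 0 := by exact_mod_cast hn.ne'
    have hfac : (Nat.factorial n : ℂ) ≠ 0 := by exact_mod_cast Nat.factorial_ne_zero n
    have hpw : (n : ℂ) ^ (z + a) ≠ 0 := by
      rw [Complex.cpow_def_of_ne_zero hnC]; exact Complex.exp_ne_zero _
    have hprod : (∏ j ∈ Finset.range (n + 1), (z + (a : ℂ) + j)) ≠ 0 := by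
      rw [Finset.prod_ne_zero_iff]
      intro j _ h
      have := congrArg Complex.im h
      simp at this
      linarith
    have he := exp_prod (L + 1) z a hzim (by simp) (n + 1)
    simp only [Pi.div_apply, Complex.GammaSeq]
    have h3 := Complex.exp_ne_zero (DD (L + 1) z a)
    rw [he]
    have h4 := Complex.exp_ne_zero (∑ j ∈ Finset.range (n + 1), etaF (L + 1) (z + j) a)
    field_simp
  refine le_of_tendsto (hlim.sub_const 1).norm ?_
  filter_upwards with n
  exact hexp (n + 1)

lemma obell_eq (p : ℕ → ℂ) (hp : p 0 = 0) (i j : ℕ) :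
    obell p i j = ∑ f ∈ Finset.Nat.antidiagonalTuple j i, ∏ l, p (f l) := by
  unfold obell
  refine Finset.sum_filter_of_ne ?_
  intro f _ hne l
  by_contra hl
  have h0 : f l = 0 := by omega
  exact hne (Finset.prod_eq_zero (Finset.mem_univ l) (by rw [h0, hp]))

lemma obell_succ (p : ℕ → ℂ) (hp : p 0 = 0) (i j : ℕ) :
    obell p i (j + 1) = ∑ q ∈ Finset.HasAntidiagonal.antidiagonal i, p q.1 * obell p q.2 j := by
  simp_rw [obell_eq p hp, Finset.mul_sum]
  rw [Finset.sum_sigma']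
  symm
  refine Finset.sum_bij' (fun x _ => Fin.cons x.1.1 x.2)
    (fun f _ => ⟨(f 0, ∑ l, Fin.tail f l), Fin.tail f⟩) ?_ ?_ ?_ ?_ ?_
  · rintro ⟨⟨a, b⟩, f⟩ h
    simp only [Finset.mem_sigma, Finset.HasAntidiagonal.mem_antidiagonal, Finset.Nat.mem_antidiagonalTuple] at h ⊢
    rw [Fin.sum_univ_succ]
    simp [h.1, h.2]
  · intro f h
    simp only [Finset.mem_sigma, Finset.HasAntidiagonal.mem_antidiagonal, Finset.Nat.mem_antidiagonalTuple] at h ⊢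
    rw [Fin.sum_univ_succ] at h
    exact ⟨h, trivial⟩
  · rintro ⟨⟨a, b⟩, f⟩ h
    simp only [Finset.mem_sigma, Finset.HasAntidiagonal.mem_antidiagonal, Finset.Nat.mem_antidiagonalTuple] at h
    obtain ⟨h1, h2⟩ := h
    subst h2
    simp
  · intro f h
    simp
  · rintro ⟨⟨a, b⟩, f⟩ h
    rw [Fin.prod_univ_succ]
    simp

lemma obell_zero (p : ℕ → ℂ) (i : ℕ) : obell p i 0 = if i = 0 then 1 else 0 := by
  unfold obell
  cases i with
  | zero => simp
  | succ n => simp [Finset.Nat.antidiagonalTuple_zero_succ]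

lemma obell_vanish (p : ℕ → ℂ) (i j : ℕ) (h : i < j) : obell p i j = 0 := by
  unfold obell
  refine Finset.sum_eq_zero ?_
  intro f hf
  exfalso
  simp only [Finset.mem_filter, Finset.Nat.mem_antidiagonalTuple] at hf
  have : ∑ l : Fin j, 1 ≤ ∑ l, f l := Finset.sum_le_sum fun l _ => hf.2 l
  simp at this
  omega

open Asymptotics Filter in
lemma mulO1 {X : Type} {l : Filter X} {f g : X → ℂ} (hf : f =O[l] (fun _ => (1 : ℂ)))
    (hg : g =O[l] (fun _ => (1 : ℂ))) : (fun x => f x * g x) =O[l] (fun _ => (1 : ℂ)) := by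
  have := hf.mul hg
  simp only [mul_one] at this
  exact this

open Asymptotics Filter in
lemma expand_mul {X : Type} {l : Filter X} {f g w : X → ℂ} {a b : ℕ → X → ℂ} (L : ℕ)
    (hw : w =O[l] (fun _ => (1 : ℂ))) (ha : ∀ m, a m =O[l] (fun _ => (1 : ℂ)))
    (hb : ∀ m, b m =O[l] (fun _ => (1 : ℂ)))
    (hf : (fun x => f x - ∑ m ∈ Finset.range L, a m x * w x ^ m) =O[l] (fun x => w x ^ L))
    (hg : (fun x => g x - ∑ m ∈ Finset.range L, b m x * w x ^ m) =O[l] (fun x => w x ^ L)) :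
    (fun x => f x * g x - ∑ m ∈ Finset.range L,
      (∑ p ∈ Finset.HasAntidiagonal.antidiagonal m, a p.1 x * b p.2 x) * w x ^ m) =O[l] (fun x => w x ^ L) := by
  have hwp : ∀ n : ℕ, (fun x => w x ^ n) =O[l] (fun _ => (1 : ℂ)) := fun n => by
    have := hw.pow n
    simp only [one_pow] at this
    exact this
  have hPa : (fun x => ∑ m ∈ Finset.range L, a m x * w x ^ m) =O[l] (fun _ => (1 : ℂ)) :=
    IsBigO.fun_sum fun m _ => mulO1 (ha m) (hwp m)
  have hPb : (fun x => ∑ m ∈ Finset.range L, b m x * w x ^ m) =O[l] (fun _ => (1 : ℂ)) :=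
    IsBigO.fun_sum fun m _ => mulO1 (hb m) (hwp m)
  have hg1 : g =O[l] (fun _ => (1 : ℂ)) := by
    exact ((hg.trans (hwp L)).add hPb).congr_left fun x => by ring
  have h1 := hf.mul hg1
  have h2 := hPa.mul hg
  simp only [mul_one, one_mul] at h1 h2
  have h3 : (fun x => ∑ p ∈ (Finset.range L ×ˢ Finset.range L).filter (fun p => ¬ p.1 + p.2 < L),
      a p.1 x * b p.2 x * w x ^ (p.1 + p.2)) =O[l] (fun x => w x ^ L) := by
    refine IsBigO.fun_sum fun p hp => ?_
    have hle : L ≤ p.1 + p.2 := by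
      have := (Finset.mem_filter.mp hp).2
      omega
    obtain ⟨d, hd⟩ := Nat.exists_eq_add_of_le hle
    rw [hd]
    have := ((ha p.1).mul (hb p.2)).mul (((hwp d).mul (isBigO_refl (fun x => w x ^ L) l)))
    simp only [mul_one, one_mul] at this
    refine this.congr_left fun x => ?_
    rw [pow_add]; ring
  refine ((h1.add h2).add h3).congr_left fun x => ?_
  have e : ∑ m ∈ Finset.range L, (∑ p ∈ Finset.HasAntidiagonal.antidiagonal m, a p.1 x * b p.2 x) * w x ^ m =
      ∑ p ∈ (Finset.range L ×ˢ Finset.range L).filter (fun p => p.1 + p.2 < L),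
        a p.1 x * b p.2 x * w x ^ (p.1 + p.2) := by
    rw [← Finset.sum_fiberwise_of_maps_to (t := Finset.range L) (g := fun p : ℕ × ℕ => p.1 + p.2)]
    · refine Finset.sum_congr rfl fun m hm => ?_
      rw [Finset.sum_mul]
      rw [Finset.mem_range] at hm
      refine Finset.sum_congr ?_ ?_
      · ext p
        simp only [Finset.HasAntidiagonal.mem_antidiagonal, Finset.mem_filter, Finset.mem_product,
          Finset.mem_range]
        omega
      · intro p hp
        rw [Finset.mem_filter] at hp
        rw [hp.2]
    · intro p hp
      exact Finset.mem_range.mpr (Finset.mem_filter.mp hp).2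
  have e2 : (∑ m ∈ Finset.range L, a m x * w x ^ m) * (∑ m ∈ Finset.range L, b m x * w x ^ m) =
      ∑ p ∈ Finset.range L ×ˢ Finset.range L, a p.1 x * b p.2 x * w x ^ (p.1 + p.2) := by
    rw [Finset.sum_mul_sum, Finset.sum_product]
    refine Finset.sum_congr rfl fun i _ => Finset.sum_congr rfl fun j _ => ?_
    rw [pow_add]; ring
  rw [e]
  rw [← Finset.sum_filter_add_sum_filter_not _ (fun p : ℕ × ℕ => p.1 + p.2 < L)] at e2
  linear_combination -e2

open Asymptotics Filter in
lemma expand_exp {X : Type} {l : Filter X} {w P : X → ℂ} {g : X → ℕ → ℂ} (L : ℕ)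
    (hw : w =O[l] (fun _ => (1 : ℂ))) (hg : ∀ m, (fun x => g x m) =O[l] (fun _ => (1 : ℂ)))
    (hg0 : ∀ x, g x 0 = 0)
    (hPw : P =O[l] w)
    (hP : (fun x => P x - ∑ m ∈ Finset.range L, g x m * w x ^ m) =O[l] (fun x => w x ^ L)) :
    (fun x => Complex.exp (P x) - ∑ m ∈ Finset.range L,
      (∑ k ∈ Finset.range (m + 1), obell (g x) m k / (Nat.factorial k : ℂ)) * w x ^ m)
      =O[l] (fun x => w x ^ L) := by
  have hob : ∀ k m, (fun x => obell (g x) m k) =O[l] (fun _ => (1 : ℂ)) := by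
    intro k
    induction k with
    | zero =>
      intro m
      simp_rw [obell_zero]
      exact isBigO_const_const _ one_ne_zero _
    | succ k ih =>
      intro m
      simp only [fun x => obell_succ (g x) (hg0 x)]
      exact IsBigO.fun_sum fun q _ => mulO1 (hg q.1) (ih q.2)
  have hpow : ∀ k, (fun x => P x ^ k - ∑ m ∈ Finset.range L, obell (g x) m k * w x ^ m)
      =O[l] (fun x => w x ^ L) := by
    intro k
    induction k with
    | zero =>
      simp_rw [obell_zero]
      cases L with
      | zero =>
        simp only [pow_zero, Finset.range_zero, Finset.sum_empty, sub_zero]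
        exact isBigO_const_const _ one_ne_zero _
      | succ L =>
        refine (isBigO_zero _ _).congr_left fun x => ?_
        rw [Finset.sum_range_succ']
        simp
    | succ k ih =>
      have := expand_mul L hw hg (hob k) hP ih
      simp only [fun x => obell_succ (g x) (hg0 x), pow_succ']
      exact this
  have hP1 : P =O[l] (fun _ => (1 : ℂ)) := hPw.trans hw
  have hexp : (fun x => Complex.exp (P x) - ∑ k ∈ Finset.range L, P x ^ k / (Nat.factorial k : ℂ))
      =O[l] (fun x => w x ^ L) := by
    refine IsBigO.trans ?_ (hPw.pow L)
    obtain ⟨c, hc⟩ := hP1.bound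
    refine IsBigO.of_bound (Real.exp c) ?_
    filter_upwards [hc] with x hx
    refine (Complex.norm_exp_sub_sum_le_norm_mul_exp _ _).trans ?_
    rw [norm_pow, mul_comm]
    simp at hx
    gcongr
  have hsum : (fun x => ∑ k ∈ Finset.range L, (Nat.factorial k : ℂ)⁻¹ *
      (P x ^ k - ∑ m ∈ Finset.range L, obell (g x) m k * w x ^ m)) =O[l] (fun x => w x ^ L) :=
    IsBigO.fun_sum fun k _ => (hpow k).const_mul_left _
  refine (hexp.add hsum).congr_left fun x => ?_
  have e : ∑ m ∈ Finset.range L,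
      (∑ k ∈ Finset.range (m + 1), obell (g x) m k / (Nat.factorial k : ℂ)) * w x ^ m =
      ∑ m ∈ Finset.range L,
      (∑ k ∈ Finset.range L, obell (g x) m k / (Nat.factorial k : ℂ)) * w x ^ m := by
    refine Finset.sum_congr rfl fun m hm => ?_
    rw [Finset.mem_range] at hm
    congr 1
    refine Finset.sum_subset ?_ ?_
    · intro k hk
      rw [Finset.mem_range] at hk ⊢
      omega
    · intro k _ hk
      rw [Finset.mem_range] at hk
      rw [obell_vanish _ _ _ (by omega), zero_div]
  rw [e]
  simp_rw [mul_sub, Finset.sum_sub_distrib, Finset.sum_mul, Finset.mul_sum]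
  rw [Finset.sum_comm (s := Finset.range L) (t := Finset.range L)
    (f := fun m k => obell (g x) m k / (Nat.factorial k : ℂ) * w x ^ m)]
  have e1 : ∀ k, (Nat.factorial k : ℂ)⁻¹ * P x ^ k = P x ^ k / (Nat.factorial k : ℂ) :=
    fun k => by ring
  have e2 : ∀ k m, (Nat.factorial k : ℂ)⁻¹ * (obell (g x) m k * w x ^ m) =
      obell (g x) m k / (Nat.factorial k : ℂ) * w x ^ m := fun k m => by ring
  simp_rw [e1, e2]
  ring

lemma gseq_zero (σ : ℝ) : gseq σ 0 = 0 := by simp [gseq]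

lemma gseq_cont (n : ℕ) : Continuous (fun σ : ℝ => gseq σ n) := by
  unfold gseq
  exact (((bern_cont (n + 1)).comp Complex.continuous_ofReal).neg).div_const _

lemma gammam_cont (m : ℕ) : Continuous (fun σ : ℝ => gammam m σ) := by
  unfold gammam obell
  refine continuous_const.mul (continuous_finsetSum _ fun k _ => Continuous.div_const ?_ _)
  exact continuous_finsetSum _ fun f _ => continuous_finsetProd _ fun l _ => gseq_cont _

lemma DD_eq (N : ℕ) (σ t : ℝ) (ht : 0 < t) :
    DD N (I * t) σ = (I * t + σ - 1 / 2) * (Real.log t + π / 2 * I) - I * t +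
      ∑ n ∈ Finset.range (N + 1), gseq σ n * (I / t) ^ n := by
  have htC : (t : ℂ) ≠ 0 := by exact_mod_cast ht.ne'
  have hlog : Complex.log (I * t) = Real.log t + π / 2 * I := by
    rw [mul_comm, Complex.log_ofReal_mul ht I_ne_zero, Complex.log_I]
  rw [DD, hlog, Finset.sum_range_succ', gseq_zero]
  simp only [zero_mul, add_zero]
  congr 1
  refine Finset.sum_congr rfl fun n _ => ?_
  have hinv : ((I * (t : ℂ)) ^ (n + 1))⁻¹ = (-1) ^ (n + 1) * (I / t) ^ (n + 1) := by
    rw [← inv_pow, ← mul_pow, mul_inv, Complex.inv_I]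
    congr 1
    field_simp
  rw [hinv, gseq]
  have hs : ((-1 : ℂ) ^ n) * (-1) ^ n = 1 := by rw [← mul_pow]; simp
  push_cast
  rw [add_assoc (n : ℂ) 1 1, one_add_one_eq_two, pow_succ (-1 : ℂ) n]
  linear_combination (-(bernoulliPoly (n + 2) σ / (((n : ℂ) + 1) * ((n : ℂ) + 2)) *
    (I / t) ^ (n + 1))) * hs

def PPs (L : ℕ) (s : ℂ) : ℂ := ∑ n ∈ Finset.range (L + 1 + 1), gseq s.re n * (I / s.im) ^ n

open Asymptotics Filter in
lemma expand_final (A B T : ℝ) (hT : 1 ≤ T) (L : ℕ) :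
    (fun s : ℂ => Complex.exp (PPs L s) - ∑ m ∈ Finset.range L, gammam m s.re / (s.im : ℂ) ^ m)
      =O[𝓟 {s : ℂ | s.re ∈ Set.Icc A B ∧ T ≤ s.im}] (fun s : ℂ => (I / (s.im : ℂ)) ^ L) := by
  have hw : (fun s : ℂ => I / (s.im : ℂ)) =O[𝓟 {s : ℂ | s.re ∈ Set.Icc A B ∧ T ≤ s.im}]
      (fun _ => (1 : ℂ)) := by
    refine IsBigO.of_bound 1 ?_
    rw [eventually_principal]
    rintro s ⟨_, hs⟩
    have : 1 ≤ s.im := hT.trans hs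
    rw [norm_div, Complex.norm_I, Complex.norm_real, Real.norm_eq_abs, abs_of_pos (by linarith)]
    simp only [norm_one, mul_one]
    rw [div_le_one (by linarith)]
    exact this
  have hg : ∀ m, (fun s : ℂ => gseq s.re m) =O[𝓟 {s : ℂ | s.re ∈ Set.Icc A B ∧ T ≤ s.im}]
      (fun _ => (1 : ℂ)) := by
    intro m
    obtain ⟨M, hM⟩ := (isCompact_Icc (a := A) (b := B)).exists_bound_of_continuousOn
      (gseq_cont m).continuousOn
    refine IsBigO.of_bound M ?_
    rw [eventually_principal]
    rintro s ⟨hs, _⟩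
    simpa using hM s.re hs
  have hterm : ∀ m d, (fun s : ℂ => gseq s.re (d + m) * (I / (s.im : ℂ)) ^ (d + m))
      =O[𝓟 {s : ℂ | s.re ∈ Set.Icc A B ∧ T ≤ s.im}] (fun s : ℂ => (I / (s.im : ℂ)) ^ m) := by
    intro m d
    have h1 := hw.pow d
    simp only [one_pow] at h1
    have := ((hg (d + m)).mul h1).mul (isBigO_refl (fun s : ℂ => (I / (s.im : ℂ)) ^ m) _)
    simp only [mul_one, one_mul] at this
    refine this.congr_left fun s => ?_
    rw [pow_add]; ring
  have hPw : PPs L =O[𝓟 {s : ℂ | s.re ∈ Set.Icc A B ∧ T ≤ s.im}]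
      (fun s : ℂ => I / (s.im : ℂ)) := by
    have : PPs L = fun s : ℂ => ∑ n ∈ Finset.range (L + 1),
        gseq s.re (n + 1) * (I / (s.im : ℂ)) ^ (n + 1) := by
      funext s
      rw [PPs, Finset.sum_range_succ', gseq_zero]
      simp
    rw [this]
    refine IsBigO.fun_sum fun n _ => ?_
    simpa only [pow_one] using hterm 1 n
  have hP : (fun s : ℂ => PPs L s - ∑ m ∈ Finset.range L, gseq s.re m * (I / (s.im : ℂ)) ^ m)
      =O[𝓟 {s : ℂ | s.re ∈ Set.Icc A B ∧ T ≤ s.im}] (fun s : ℂ => (I / (s.im : ℂ)) ^ L) := by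
    have h0 := hterm L 0
    have h1 := hterm L 1
    rw [zero_add] at h0
    rw [add_comm 1 L] at h1
    refine (h0.add h1).congr_left fun s => ?_
    rw [PPs, Finset.sum_range_succ, Finset.sum_range_succ]
    ring
  refine (expand_exp L hw hg (fun s => gseq_zero s.re) hPw hP).congr_left fun s => ?_
  congr 1
  refine Finset.sum_congr rfl fun m _ => ?_
  rw [gammam, div_pow]
  ring

lemma main_eq (L : ℕ) (s : ℂ) (hs : 0 < s.im) :
    Complex.Gamma s * ((Real.sqrt (2*π) : ℂ))⁻¹ *
            Complex.exp (-(π:ℂ)*I*s/2 + I*(s.im:ℂ) + (π:ℂ)*I/4) *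
            Complex.exp ((1/2 - s) * (Real.log s.im : ℂ)) =
    Complex.Gamma (I * s.im + s.re) / (((Real.sqrt (2 * π) : ℝ) : ℂ) *
      Complex.exp (DD (L + 1) (I * s.im) s.re)) * Complex.exp (PPs L s) := by
  have hse : I * (s.im : ℂ) + s.re = s := by
    conv_rhs => rw [← Complex.re_add_im s]
    ring
  have hDD : DD (L + 1) (I * s.im) s.re = -(-(π:ℂ)*I*s/2 + I*(s.im:ℂ) + (π:ℂ)*I/4) -
      ((1/2 - s) * (Real.log s.im : ℂ)) + PPs L s := by
    rw [DD_eq _ _ _ hs, PPs, hse]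
    ring
  rw [hDD, hse]
  generalize (-(π:ℂ)*I*s/2 + I*(s.im:ℂ) + (π:ℂ)*I/4) = u
  generalize (1/2 - s) * (Real.log s.im : ℂ) = v
  rw [Complex.exp_add, Complex.exp_sub, Complex.exp_neg]
  have h1 := Complex.exp_ne_zero (PPs L s)
  field_simp

theorem statement19 (A B : ℝ) (ε : ℝ) (hε : 0 < ε) (L : ℕ) :
    ∃ C : ℝ, ∀ s : ℂ, s.re ∈ Set.Icc A B → ε ≤ s.im →
      ‖Complex.Gamma s * ((Real.sqrt (2*π) : ℂ))⁻¹ *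
            Complex.exp (-(π:ℂ)*I*s/2 + I*(s.im:ℂ) + (π:ℂ)*I/4) *
            Complex.exp ((1/2 - s) * (Real.log s.im : ℂ))
          - ∑ m ∈ Finset.range L, gammam m s.re / (s.im:ℂ)^m‖
        ≤ C / s.im^L := by
  obtain ⟨C0, T, hT, hG⟩ := gamma_main A B L
  obtain ⟨C1, hC1⟩ := (expand_final A B T hT L).bound
  rw [Filter.eventually_principal] at hC1
  have hcont : ContinuousOn (fun s : ℂ => Complex.Gamma s * ((Real.sqrt (2*π) : ℂ))⁻¹ *
            Complex.exp (-(π:ℂ)*I*s/2 + I*(s.im:ℂ) + (π:ℂ)*I/4) *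
            Complex.exp ((1/2 - s) * (Real.log s.im : ℂ))
          - ∑ m ∈ Finset.range L, gammam m s.re / (s.im:ℂ)^m)
      (Set.Icc A B ×ℂ Set.Icc ε T) := by
    intro s hs
    have him : 0 < s.im := lt_of_lt_of_le hε hs.2.1
    have himC : (s.im : ℂ) ≠ 0 := by exact_mod_cast him.ne'
    refine ContinuousAt.continuousWithinAt ?_
    have hΓ : ContinuousAt Complex.Gamma s := by
      refine (Complex.differentiableAt_Gamma s fun m h => ?_).continuousAt
      have := congrArg Complex.im h
      simp at this
      linarith
    have hlog : ContinuousAt (fun s : ℂ => (Real.log s.im : ℂ)) s :=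
      Complex.continuous_ofReal.continuousAt.comp
        ((Real.continuousAt_log him.ne').comp Complex.continuous_im.continuousAt)
    have hsum : ContinuousAt (fun s : ℂ => ∑ m ∈ Finset.range L,
        gammam m s.re / (s.im:ℂ)^m) s := by
      refine tendsto_finsetSum _ fun m _ => ?_
      exact ((gammam_cont m).comp Complex.continuous_re).continuousAt.div
        ((Complex.continuous_ofReal.comp Complex.continuous_im).continuousAt.pow m)
        (pow_ne_zero _ himC)
    have he1 : ContinuousAt (fun s : ℂ => Complex.exp (-(π:ℂ)*I*s/2 + I*(s.im:ℂ) + (π:ℂ)*I/4)) s :=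
      by
        refine Continuous.continuousAt ?_
        fun_prop
    have he2 : ContinuousAt (fun s : ℂ => Complex.exp ((1/2 - s) * (Real.log s.im : ℂ))) s :=
      ((continuousAt_const.sub continuousAt_id).mul hlog).cexp
    exact (((hΓ.mul continuousAt_const).mul he1).mul he2).sub hsum
  have hK : IsCompact (Set.Icc A B ×ℂ Set.Icc ε T) := isCompact_Icc.reProdIm isCompact_Icc
  obtain ⟨C2, hC2⟩ := hK.exists_bound_of_continuousOn hcont
  obtain ⟨C3, hC3⟩ : ∃ C3 : ℝ, ∀ s : ℂ, s.re ∈ Set.Icc A B → T ≤ s.im →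
      ‖Complex.exp (PPs L s)‖ ≤ C3 := by
    obtain ⟨C5, hC5⟩ := (isCompact_Icc (a := A) (b := B)).exists_bound_of_continuousOn
      (f := fun σ : ℝ => ∑ m ∈ Finset.range L, ‖gammam m σ‖)
      (continuous_finsetSum _ fun m _ => (gammam_cont m).norm).continuousOn
    refine ⟨|C1| + C5, fun s hs ht => ?_⟩
    have him : 1 ≤ s.im := hT.trans ht
    have h1 := hC1 s ⟨hs, ht⟩
    have hn : ‖(s.im : ℂ)‖ = s.im := by
      rw [Complex.norm_real, Real.norm_eq_abs, abs_of_pos (by linarith)]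
    rw [norm_pow, norm_div, Complex.norm_I, hn] at h1
    have h2 : C1 * (1 / s.im) ^ L ≤ |C1| := by
      have a1 : (1 / s.im) ^ L ≤ 1 := pow_le_one₀ (by positivity)
        ((div_le_one (by linarith)).mpr him)
      have a2 : 0 ≤ (1 / s.im) ^ L := by positivity
      calc C1 * (1 / s.im) ^ L ≤ |C1| * (1 / s.im) ^ L := by gcongr; exact le_abs_self _
        _ ≤ |C1| * 1 := by gcongr
        _ = _ := mul_one _
    have h3 : ‖∑ m ∈ Finset.range L, gammam m s.re / (s.im:ℂ)^m‖ ≤ C5 := by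
      refine (norm_sum_le _ _).trans ?_
      refine le_trans (Finset.sum_le_sum fun m _ => ?_) ((le_abs_self _).trans (hC5 s.re hs))
      rw [norm_div, norm_pow, hn]
      exact div_le_self (norm_nonneg _) (one_le_pow₀ him)
    have h4 := norm_add_le (Complex.exp (PPs L s) -
      ∑ m ∈ Finset.range L, gammam m s.re / (s.im:ℂ)^m)
      (∑ m ∈ Finset.range L, gammam m s.re / (s.im:ℂ)^m)
    rw [sub_add_cancel] at h4
    linarith
  refine ⟨max (|C0| * |C3| + C1) (|C2| * T ^ L), fun s hs ht => ?_⟩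
  have him : 0 < s.im := lt_of_lt_of_le hε ht
  by_cases hcase : T ≤ s.im
  · have h1 := hC1 s ⟨hs, hcase⟩
    have hn : ‖(s.im : ℂ)‖ = s.im := by
      rw [Complex.norm_real, Real.norm_eq_abs, abs_of_pos him]
    rw [norm_pow, norm_div, Complex.norm_I, hn] at h1
    have h2 := hG s.re hs s.im hcase
    have h3 := hC3 s hs hcase
    rw [main_eq L s him]
    set H := Complex.Gamma (I * s.im + s.re) / (((Real.sqrt (2 * π) : ℝ) : ℂ) *
      Complex.exp (DD (L + 1) (I * s.im) s.re))
    set E := Complex.exp (PPs L s)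
    set Q := ∑ m ∈ Finset.range L, gammam m s.re / (s.im:ℂ)^m
    have e : H * E - Q = (H - 1) * E + (E - Q) := by ring
    rw [e]
    calc _ ≤ ‖(H - 1) * E‖ + ‖E - Q‖ := norm_add_le _ _
      _ ≤ |C0| / s.im ^ L * |C3| + C1 * (1 / s.im) ^ L := by
        rw [norm_mul]
        have h2' : ‖H - 1‖ ≤ |C0| / s.im ^ L := h2.trans (by gcongr; exact le_abs_self _)
        have h3' : ‖E‖ ≤ |C3| := h3.trans (le_abs_self _)
        gcongr
      _ = (|C0| * |C3| + C1) / s.im ^ L := by rw [one_div, inv_pow]; ring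
      _ ≤ _ := by gcongr; exact le_max_left _ _
  · push Not at hcase
    refine (hC2 s ⟨hs, ht, hcase.le⟩).trans ?_
    rw [le_div_iff₀ (by positivity)]
    calc C2 * s.im ^ L ≤ |C2| * T ^ L := by
          gcongr
          exact le_abs_self _
      _ ≤ _ := le_max_right _ _


end
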